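/- arXiv:2507.21494 — 12 statements merged into one kernel-verified Lean document; each statement's English description precedes it below -/
import Mathlib

section
/- Let d ≥ 1, let μ ∈ ℝ^d, let w_pre ∈ ℝ^d with ‖w_pre‖ = 1 and ⟪μ, w_pre⟫ > 0, and let b_pre ∈ ℝ. Define w_asym = (μ + w_pre)/‖μ + w_pre‖. Then ε(w_asym, 0) ≤ ε(w_pre, b_pre); that is, the converged memory classifier through the relocated class prototypes ±(μ + w_pre) has error rate no larger than that of the initial linear classifier. -/
open MeasureTheory Metric RealInnerProductSpace

/-- Error rate of the linear classifier `f ↦ 1{⟪f,w⟫ + b > 0}` on the balanced two-class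
mixture with class 0 uniform on `closedBall (-μ) 1` and class 1 uniform on `closedBall μ 1`. -/
noncomputable def errRate (d : ℕ) (μ w : EuclideanSpace ℝ (Fin d)) (b : ℝ) : ℝ :=
  (1 / 2) *
    (((volume {f : EuclideanSpace ℝ (Fin d) | f ∈ closedBall (-μ) 1 ∧ ⟪f, w⟫ + b > 0}).toReal
      + (volume {f : EuclideanSpace ℝ (Fin d) | f ∈ closedBall μ 1 ∧ ⟪f, w⟫ + b ≤ 0}).toReal)
    / (volume (closedBall (0 : EuclideanSpace ℝ (Fin d)) 1)).toReal)

/-- Open cap of the unit ball. -/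
def capO {d : ℕ} (w : EuclideanSpace ℝ (Fin d)) (t : ℝ) : Set (EuclideanSpace ℝ (Fin d)) :=
  {g | ‖g‖ ≤ 1 ∧ t < ⟪g, w⟫}

/-- Closed cap of the unit ball. -/
def capC {d : ℕ} (w : EuclideanSpace ℝ (Fin d)) (t : ℝ) : Set (EuclideanSpace ℝ (Fin d)) :=
  {g | ‖g‖ ≤ 1 ∧ t ≤ ⟪g, w⟫}

section aux
variable {d : ℕ}

lemma meas_ball : MeasurableSet {g : EuclideanSpace ℝ (Fin d) | ‖g‖ ≤ 1} :=
  (isClosed_le (by fun_prop) (by fun_prop)).measurableSet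

lemma meas_lt (w : EuclideanSpace ℝ (Fin d)) (t : ℝ) :
    MeasurableSet {g : EuclideanSpace ℝ (Fin d) | t < ⟪g, w⟫} :=
  (isOpen_lt (by fun_prop) (by fun_prop)).measurableSet

lemma meas_le (w : EuclideanSpace ℝ (Fin d)) (t : ℝ) :
    MeasurableSet {g : EuclideanSpace ℝ (Fin d) | t ≤ ⟪g, w⟫} :=
  (isClosed_le (by fun_prop) (by fun_prop)).measurableSet

lemma meas_capO (w : EuclideanSpace ℝ (Fin d)) (t : ℝ) : MeasurableSet (capO w t) :=
  meas_ball.inter (meas_lt w t)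

lemma meas_capC (w : EuclideanSpace ℝ (Fin d)) (t : ℝ) : MeasurableSet (capC w t) :=
  meas_ball.inter (meas_le w t)

lemma cap_fin {s : Set (EuclideanSpace ℝ (Fin d))} (h : ∀ g ∈ s, ‖g‖ ≤ 1) : volume s ≠ ⊤ := by
  refine ((measure_mono (t := closedBall 0 1) ?_).trans_lt measure_closedBall_lt_top).ne
  intro g hg
  simpa using h g hg

lemma vol0 (μ w : EuclideanSpace ℝ (Fin d)) (b : ℝ) :
    volume {f : EuclideanSpace ℝ (Fin d) | f ∈ closedBall (-μ) 1 ∧ ⟪f, w⟫ + b > 0}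
      = volume (capO w (⟪μ, w⟫ - b)) := by
  rw [← measure_preimage_add_right volume μ (capO w (⟪μ, w⟫ - b))]
  congr 1
  ext f
  simp only [capO, Set.mem_ofPred_eq, Set.mem_preimage, mem_closedBall, dist_eq_norm,
    sub_neg_eq_add, inner_add_left]
  constructor <;> rintro ⟨h1, h2⟩ <;> exact ⟨h1, by linarith⟩

lemma vol1 (μ w : EuclideanSpace ℝ (Fin d)) (b : ℝ) :
    volume {f : EuclideanSpace ℝ (Fin d) | f ∈ closedBall μ 1 ∧ ⟪f, w⟫ + b ≤ 0}
      = volume (capC w (⟪μ, w⟫ + b)) := by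
  rw [← (Measure.measurePreserving_sub_left volume μ).measure_preimage
    (meas_capC w (⟪μ, w⟫ + b)).nullMeasurableSet]
  congr 1
  ext f
  simp only [capC, Set.mem_ofPred_eq, Set.mem_preimage, mem_closedBall, dist_eq_norm,
    inner_sub_left, norm_sub_rev f μ]
  constructor <;> rintro ⟨h1, h2⟩ <;> exact ⟨h1, by linarith⟩

/-- Rotation invariance. -/
lemma cap_rot (v w : EuclideanSpace ℝ (Fin d)) (h : ‖v‖ = ‖w‖) (t : ℝ) :
    volume (capO v t) = volume (capO w t) ∧ volume (capC v t) = volume (capC w t) := by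
  set R := (ℝ ∙ (v - w))ᗮ.reflection with hR
  have hv : R v = w := Submodule.reflection_sub h
  have key : ∀ g, ⟪R g, w⟫ = ⟪g, v⟫ := fun g => by
    rw [← hv, R.inner_map_map]
  constructor
  · rw [← R.measurePreserving.measure_preimage (meas_capO w t).nullMeasurableSet]
    congr 1
    ext g
    simp only [capO, Set.mem_ofPred_eq, Set.mem_preimage, key, R.norm_map]
  · rw [← R.measurePreserving.measure_preimage (meas_capC w t).nullMeasurableSet]
    congr 1
    ext g
    simp only [capC, Set.mem_ofPred_eq, Set.mem_preimage, key, R.norm_map]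

/-- Reflection across the hyperplane `⟪g, w⟫ = m`. -/
lemma refl_le (w : EuclideanSpace ℝ (Fin d)) (hw : ‖w‖ = 1) (m : ℝ) (hm : 0 ≤ m)
    (s t : Set (EuclideanSpace ℝ (Fin d))) (ht : MeasurableSet t)
    (hst : ∀ g ∈ s, ‖g‖ ≤ 1 ∧ m ≤ ⟪g, w⟫)
    (hmap : ∀ g ∈ s, ∀ g', ‖g'‖ ≤ 1 → ⟪g', w⟫ = 2 * m - ⟪g, w⟫ → g' ∈ t) :
    volume s ≤ volume t := by
  set R := (ℝ ∙ w)ᗮ.reflection with hR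
  have hRw : R w = -w := Submodule.reflection_orthogonalComplement_singleton_eq_neg w
  have hww : ⟪w, w⟫ = 1 := by rw [real_inner_self_eq_norm_sq, hw]; norm_num
  have hin : ∀ g, ⟪R g, w⟫ = -⟪g, w⟫ := fun g => by
    have := R.inner_map_map g w
    rw [hRw, inner_neg_right] at this
    linarith
  have hmp : MeasurePreserving (fun g => R g + (2 * m) • w) volume volume :=
    (measurePreserving_add_right volume ((2 * m) • w)).comp R.measurePreserving
  rw [← hmp.measure_preimage ht.nullMeasurableSet]
  apply measure_mono
  intro g hg
  obtain ⟨h1, h2⟩ := hst g hg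
  apply hmap g hg
  · have e : ‖R g + (2 * m) • w‖ ^ 2 = ‖g‖ ^ 2 - 4 * m * (⟪g, w⟫ - m) := by
      rw [norm_add_sq_real, inner_smul_right, hin, R.norm_map, norm_smul, hw, mul_one,
        Real.norm_eq_abs, sq_abs]
      ring
    have : 0 ≤ m * (⟪g, w⟫ - m) := mul_nonneg hm (by linarith)
    have h0 := norm_nonneg g
    refine (sq_le_one_iff₀ (norm_nonneg _)).1 ?_
    nlinarith
  · rw [inner_add_left, inner_smul_left, hin, hww]
    simp
    ring

lemma cap_shift (w : EuclideanSpace ℝ (Fin d)) (hw : ‖w‖ = 1) (m : ℝ) (hm : 0 ≤ m) (b : ℝ) :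
    volume (capO w m) + volume (capC w m) ≤ volume (capO w (m - b)) + volume (capC w (m + b)) := by
  rcases le_total 0 b with hb | hb
  · have hs1 : capO w m ⊆ capO w (m - b) := fun g hg => ⟨hg.1, by linarith [hg.2]⟩
    have hs2 : capC w (m + b) ⊆ capC w m := fun g hg => ⟨hg.1, by linarith [hg.2]⟩
    rw [← measure_sdiff_add_inter (μ := volume) (s := capO w (m - b)) (t := capO w m) (meas_capO w m),
      ← measure_sdiff_add_inter (μ := volume) (s := capC w m) (t := capC w (m + b)) (meas_capC w _),
      Set.inter_eq_right.2 hs1, Set.inter_eq_right.2 hs2]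
    have := refl_le w hw m hm (capC w m \ capC w (m + b)) (capO w (m - b) \ capO w m)
      ((meas_capO w _).diff (meas_capO w _)) (fun g hg => hg.1) (by
        rintro g ⟨⟨h1, h2⟩, h3⟩ g' h4 h5
        have h6 : ⟪g, w⟫ < m + b := by
          by_contra h; exact h3 ⟨h1, not_lt.1 h⟩
        exact ⟨⟨h4, by linarith⟩, fun h => by linarith [h.2]⟩)
    rw [← add_assoc, add_comm (volume (capO w m))]
    gcongr
  · have hs1 : capO w (m - b) ⊆ capO w m := fun g hg => ⟨hg.1, by linarith [hg.2]⟩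
    have hs2 : capC w m ⊆ capC w (m + b) := fun g hg => ⟨hg.1, by linarith [hg.2]⟩
    rw [← measure_sdiff_add_inter (μ := volume) (s := capO w m) (t := capO w (m - b)) (meas_capO w _),
      ← measure_sdiff_add_inter (μ := volume) (s := capC w (m + b)) (t := capC w m) (meas_capC w _),
      Set.inter_eq_right.2 hs1, Set.inter_eq_right.2 hs2]
    have := refl_le w hw m hm (capO w m \ capO w (m - b)) (capC w (m + b) \ capC w m)
      ((meas_capC w _).diff (meas_capC w _)) (fun g hg => ⟨hg.1.1, hg.1.2.le⟩) (by
        rintro g ⟨⟨h1, h2⟩, h3⟩ g' h4 h5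
        have h6 : ⟪g, w⟫ ≤ m - b := by
          by_contra h; exact h3 ⟨h1, not_le.1 h⟩
        exact ⟨⟨h4, by linarith⟩, fun h => by linarith [h.2]⟩)
    rw [add_comm (volume (_ \ _)), add_assoc]
    gcongr

end aux

theorem stmt0 (d : ℕ) (hd : 1 ≤ d) (μ w_pre : EuclideanSpace ℝ (Fin d))
    (hw : ‖w_pre‖ = 1) (hμw : ⟪μ, w_pre⟫ > 0) (b_pre : ℝ) :
    errRate d μ (‖μ + w_pre‖⁻¹ • (μ + w_pre)) 0 ≤ errRate d μ w_pre b_pre := by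
  set m := ⟪μ, w_pre⟫ with hm
  have hsq : ‖μ + w_pre‖ ^ 2 = ‖μ‖ ^ 2 + 2 * m + 1 := by
    rw [norm_add_sq_real, hw]; ring
  have hpos : 0 < ‖μ + w_pre‖ := by
    have h0 := norm_nonneg (μ + w_pre)
    have h1 := sq_nonneg ‖μ‖
    by_contra h
    have : ‖μ + w_pre‖ = 0 := by linarith
    rw [this] at hsq
    nlinarith
  set a := ‖μ + w_pre‖⁻¹ • (μ + w_pre) with ha
  have han : ‖a‖ = ‖w_pre‖ := by
    rw [ha, norm_smul, norm_inv, norm_norm, inv_mul_cancel₀ hpos.ne', hw]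
  have hma : m ≤ ⟪μ, a⟫ := by
    rw [ha, inner_smul_right, inner_add_right, real_inner_self_eq_norm_sq, ← hm,
      le_inv_mul_iff₀ hpos]
    have hmr : m ≤ ‖μ‖ := by
      have := real_inner_le_norm μ w_pre
      rwa [hw, mul_one] at this
    have hmr2 : m ^ 2 ≤ ‖μ‖ ^ 2 := by gcongr
    refine le_of_sq_le_sq ?_ (by positivity)
    rw [mul_pow, hsq]
    nlinarith [mul_nonneg (sq_nonneg ‖μ‖) (sub_nonneg.2 hmr2),
      mul_nonneg hμw.le (sub_nonneg.2 hmr2)]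
  unfold errRate
  rw [vol0, vol1, vol0, vol1, (cap_rot a w_pre han _).1, (cap_rot a w_pre han _).2, ← hm,
    sub_zero, add_zero]
  have fO : ∀ t, volume (capO w_pre t) ≠ ⊤ := fun t => cap_fin fun g hg => hg.1
  have fC : ∀ t, volume (capC w_pre t) ≠ ⊤ := fun t => cap_fin fun g hg => hg.1
  rw [← ENNReal.toReal_add (fO _) (fC _), ← ENNReal.toReal_add (fO _) (fC _)]
  have hfin : volume (capO w_pre (m - b_pre)) + volume (capC w_pre (m + b_pre)) ≠ ⊤ :=
    ENNReal.add_ne_top.2 ⟨fO _, fC _⟩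
  refine mul_le_mul_of_nonneg_left (div_le_div_of_nonneg_right
    (ENNReal.toReal_mono hfin ?_) ENNReal.toReal_nonneg) (by norm_num)
  · refine le_trans (add_le_add (measure_mono ?_) (measure_mono ?_))
      (cap_shift w_pre hw m hμw.le b_pre)
    · exact fun g hg => ⟨hg.1, hma.trans_lt hg.2⟩
    · exact fun g hg => ⟨hg.1, hma.trans hg.2⟩
end

section
/- Let d ≥ 1 and let μ, w ∈ ℝ^d satisfy ‖w‖ = 1 and ⟪μ, w⟫ > 0. Then ⟪μ, (μ + w)/‖μ + w‖⟫ ≥ ⟪μ, w⟫; i.e., normalizing the sum of the class-center direction and the classifier weight yields a unit vector whose inner product with μ is at least that of the original unit weight. -/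
open RealInnerProductSpace

theorem stmt1 (d : ℕ) (hd : 1 ≤ d) (μ w : EuclideanSpace ℝ (Fin d))
    (hw : ‖w‖ = 1) (hμw : ⟪μ, w⟫ > 0) :
    ⟪μ, w⟫ ≤ ⟪μ, ‖μ + w‖⁻¹ • (μ + w)⟫ := by
  have hcs : ⟪μ, w⟫ ≤ ‖μ‖ := by
    have h := real_inner_le_norm μ w
    rwa [hw, mul_one] at h
  have hN : ‖μ + w‖ ^ 2 = ‖μ‖ ^ 2 + 2 * ⟪μ, w⟫ + 1 := by
    rw [norm_add_sq_real, hw]; ring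
  have hpos : 0 < ‖μ + w‖ := by
    have h0 := norm_nonneg (μ + w)
    rcases h0.lt_or_eq with h | h
    · exact h
    · rw [← h] at hN
      nlinarith [sq_nonneg ‖μ‖]
  rw [inner_smul_right, inner_add_right, real_inner_self_eq_norm_sq, inv_mul_eq_div,
    le_div_iff₀ hpos]
  generalize ⟪μ, w⟫ = a at *
  generalize ‖μ + w‖ = N at *
  generalize ‖μ‖ = m at *
  have hsq : 0 ≤ m ^ 2 - a ^ 2 := by nlinarith
  have hr : 0 ≤ m ^ 2 + a := by positivity
  refine abs_le_of_sq_le_sq' ?_ hr |>.2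
  rw [mul_pow, hN]
  have h1 : 0 ≤ (m ^ 2 + 2 * a) * (m ^ 2 - a ^ 2) := mul_nonneg (by positivity) hsq
  nlinarith [h1]
end

section
/- Let d ≥ 1, let μ ∈ ℝ^d, and let w ∈ ℝ^d with ‖w‖ = 1 and b ∈ ℝ. Then ε(w, b) < 1/2 if and only if ⟪μ, w⟫ > 0 and −⟪μ, w⟫ − 1 < b < ⟪μ, w⟫ + 1. -/
open MeasureTheory Metric RealInnerProductSpace

/-- Volume of the part of the unit ball below level `c` in direction `w`. -/
noncomputable def capVol (d : ℕ) (w : EuclideanSpace ℝ (Fin d)) (c : ℝ) : ℝ :=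
  (volume {g : EuclideanSpace ℝ (Fin d) | g ∈ closedBall 0 1 ∧ ⟪g, w⟫ ≤ c}).toReal

theorem ball_part_ne_top (d : ℕ) (p : EuclideanSpace ℝ (Fin d) → Prop) :
    volume {g : EuclideanSpace ℝ (Fin d) | g ∈ closedBall 0 1 ∧ p g} ≠ ⊤ :=
  measure_ne_top_of_subset (fun _ h => h.1) measure_closedBall_lt_top.ne

theorem capVol_mono (d : ℕ) (w : EuclideanSpace ℝ (Fin d)) {a c : ℝ} (h : a ≤ c) :
    capVol d w a ≤ capVol d w c :=
  ENNReal.toReal_mono (ball_part_ne_top d _) (measure_mono fun _ hg => ⟨hg.1, hg.2.trans h⟩)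

theorem capVol_lt_iff (d : ℕ) (w : EuclideanSpace ℝ (Fin d)) (hw : ‖w‖ = 1) (a c : ℝ) :
    capVol d w a < capVol d w c ↔ a < c ∧ a < 1 ∧ -1 < c := by
  constructor
  · intro h
    refine ⟨?_, ?_, ?_⟩
    · by_contra! hc
      exact absurd h (not_lt.2 (capVol_mono d w hc))
    · by_contra! hc
      refine absurd h (not_lt.2 ?_)
      refine ENNReal.toReal_mono (ball_part_ne_top d _) (measure_mono fun g hg => ⟨hg.1, ?_⟩)
      have h1 := real_inner_le_norm g w
      have h2 : ‖g‖ ≤ 1 := by simpa using hg.1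
      rw [hw] at h1
      linarith
    · by_contra! hc
      have h0 : capVol d w c = 0 := by
        have : volume {g : EuclideanSpace ℝ (Fin d) | g ∈ closedBall 0 1 ∧ ⟪g, w⟫ ≤ c} = 0 := by
          refine measure_mono_null (t := sphere 0 1) (fun g hg => ?_)
            (Measure.addHaar_sphere_of_ne_zero volume 0 one_ne_zero)
          have h2 : ‖g‖ ≤ 1 := by simpa using hg.1
          have h1 := (abs_le.1 (abs_real_inner_le_norm g w)).1
          have h3 := hg.2
          rw [hw] at h1
          have : ‖g‖ = 1 := by linarith
          simpa using this
        rw [capVol, this, ENNReal.toReal_zero]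
      rw [h0] at h
      exact absurd h (not_lt.2 ENNReal.toReal_nonneg)
  · rintro ⟨h1, h2, h3⟩
    obtain ⟨t, ht1, ht2⟩ := exists_between
      (show max a (-1) < min c 1 from max_lt (lt_min h1 h2) (lt_min h3 (by norm_num)))
    obtain ⟨hta, htm⟩ := max_lt_iff.1 ht1
    obtain ⟨htc, htp⟩ := lt_min_iff.1 ht2
    have hcont : Continuous fun g : EuclideanSpace ℝ (Fin d) => ⟪g, w⟫ := by fun_prop
    let U : Set (EuclideanSpace ℝ (Fin d)) := ball 0 1 ∩ (fun g => ⟪g, w⟫) ⁻¹' Set.Ioo a c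
    have hU : IsOpen U := isOpen_ball.inter (isOpen_Ioo.preimage hcont)
    have hne : U.Nonempty := by
      refine ⟨t • w, ?_, ?_⟩
      · simp [norm_smul, hw, abs_lt, htm, htp]
      · simp [real_inner_smul_left, hw, hta, htc]
    have hpos : 0 < volume U := hU.measure_pos volume hne
    have hfin := ball_part_ne_top d (fun g => ⟪g, w⟫ ≤ c)
    have hfa := ball_part_ne_top d (fun g => ⟪g, w⟫ ≤ a)
    refine (ENNReal.toReal_lt_toReal hfa hfin).2 ?_
    refine lt_of_lt_of_le (ENNReal.lt_add_right hfa hpos.ne') ?_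
    rw [← measure_union _ hU.measurableSet]
    · refine measure_mono (Set.union_subset (fun g hg => ⟨hg.1, hg.2.trans h1.le⟩) fun g hg => ?_)
      exact ⟨ball_subset_closedBall hg.1, hg.2.2.le⟩
    · rw [Set.disjoint_left]
      intro g hg hg'
      exact absurd hg'.2.1 (not_lt.2 hg.2)

theorem errRate_eq (d : ℕ) (μ w : EuclideanSpace ℝ (Fin d)) (b : ℝ) :
    errRate d μ w b = (1 / 2) *
      (((volume (closedBall (0 : EuclideanSpace ℝ (Fin d)) 1)).toReal
        - capVol d w (⟪μ, w⟫ - b) + capVol d w (-⟪μ, w⟫ - b))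
      / (volume (closedBall (0 : EuclideanSpace ℝ (Fin d)) 1)).toReal) := by
  have e1 : volume {f : EuclideanSpace ℝ (Fin d) | f ∈ closedBall (-μ) 1 ∧ ⟪f, w⟫ + b > 0}
      = volume {g : EuclideanSpace ℝ (Fin d) | g ∈ closedBall 0 1 ∧ ⟪μ, w⟫ - b < ⟪g, w⟫} := by
    rw [← measure_preimage_add_right volume (-μ)]
    congr 1
    ext g
    simp only [Set.mem_preimage, Set.mem_ofPred_eq, mem_closedBall, dist_eq_norm, inner_add_left,
      inner_neg_left, add_sub_cancel_right, sub_zero]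
    refine and_congr_right fun _ => ?_
    constructor <;> intro h <;> linarith
  have e2 : volume {f : EuclideanSpace ℝ (Fin d) | f ∈ closedBall μ 1 ∧ ⟪f, w⟫ + b ≤ 0}
      = volume {g : EuclideanSpace ℝ (Fin d) | g ∈ closedBall 0 1 ∧ ⟪g, w⟫ ≤ -⟪μ, w⟫ - b} := by
    rw [← measure_preimage_add_right volume μ]
    congr 1
    ext g
    simp only [Set.mem_preimage, Set.mem_ofPred_eq, mem_closedBall, dist_eq_norm, inner_add_left,
      add_sub_cancel_right, sub_zero]
    refine and_congr_right fun _ => ?_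
    constructor <;> intro h <;> linarith
  have hcont : Continuous fun g : EuclideanSpace ℝ (Fin d) => ⟪g, w⟫ := by fun_prop
  have e3 : (volume (closedBall (0 : EuclideanSpace ℝ (Fin d)) 1)).toReal
      = capVol d w (⟪μ, w⟫ - b) + (volume {g : EuclideanSpace ℝ (Fin d) |
          g ∈ closedBall 0 1 ∧ ⟪μ, w⟫ - b < ⟪g, w⟫}).toReal := by
    have hm : MeasurableSet {g : EuclideanSpace ℝ (Fin d) | ⟪g, w⟫ ≤ ⟪μ, w⟫ - b} :=
      (isClosed_le hcont continuous_const).measurableSet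
    rw [capVol, ← ENNReal.toReal_add (ball_part_ne_top d _) (ball_part_ne_top d _),
      ← measure_inter_add_sdiff (closedBall (0 : EuclideanSpace ℝ (Fin d)) 1) hm]
    congr 3
    ext g
    simp
  rw [errRate, e1, e2]
  change 1 / 2 * ((_ + capVol d w (-⟪μ, w⟫ - b)) / _) = _
  congr 3
  linarith

theorem stmt2 (d : ℕ) (hd : 1 ≤ d) (μ w : EuclideanSpace ℝ (Fin d))
    (hw : ‖w‖ = 1) (b : ℝ) :
    errRate d μ w b < 1 / 2 ↔
      ⟪μ, w⟫ > 0 ∧ -⟪μ, w⟫ - 1 < b ∧ b < ⟪μ, w⟫ + 1 := by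
  have hV : 0 < (volume (closedBall (0 : EuclideanSpace ℝ (Fin d)) 1)).toReal :=
    ENNReal.toReal_pos (measure_closedBall_pos volume _ one_pos).ne' measure_closedBall_lt_top.ne
  have key : errRate d μ w b < 1 / 2 ↔
      capVol d w (-⟪μ, w⟫ - b) < capVol d w (⟪μ, w⟫ - b) := by
    rw [errRate_eq, mul_lt_iff_lt_one_right (by norm_num), div_lt_one hV]
    constructor <;> intro h <;> linarith
  rw [key, capVol_lt_iff d w hw]
  constructor
  · rintro ⟨h1, h2, h3⟩
    exact ⟨by linarith, by linarith, by linarith⟩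
  · rintro ⟨h1, h2, h3⟩
    exact ⟨by linarith, by linarith, by linarith⟩
end

section
/- Let d ≥ 1, let μ ∈ ℝ^d, and let w₁, w₂ ∈ ℝ^d be unit vectors with ⟪μ, w₁⟫ ≥ ⟪μ, w₂⟫. Then vol{f ∈ closedBall(μ, 1) : ⟪f, w₁⟫ ≤ 0} ≤ vol{f ∈ closedBall(μ, 1) : ⟪f, w₂⟫ ≤ 0}; i.e., for a zero-bias linear classifier on the unit ball centered at μ, the misclassified volume is monotonically non-increasing in the alignment ⟪μ, w⟫ of the unit weight with the center. -/
open MeasureTheory Metric RealInnerProductSpace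

theorem stmt3 (d : ℕ) (hd : 1 ≤ d) (μ w₁ w₂ : EuclideanSpace ℝ (Fin d))
    (hw₁ : ‖w₁‖ = 1) (hw₂ : ‖w₂‖ = 1) (h : ⟪μ, w₂⟫ ≤ ⟪μ, w₁⟫) :
    volume {f : EuclideanSpace ℝ (Fin d) | f ∈ closedBall μ 1 ∧ ⟪f, w₁⟫ ≤ 0}
      ≤ volume {f : EuclideanSpace ℝ (Fin d) | f ∈ closedBall μ 1 ∧ ⟪f, w₂⟫ ≤ 0} := by
  obtain ⟨R, hR⟩ : ∃ R : EuclideanSpace ℝ (Fin d) ≃ₗᵢ[ℝ] EuclideanSpace ℝ (Fin d), R w₁ = w₂ :=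
    ⟨_, Submodule.reflection_sub (hw₁.trans hw₂.symm)⟩
  have hT : MeasurePreserving (fun f : EuclideanSpace ℝ (Fin d) => μ + R (f - μ))
      volume volume :=
    (measurePreserving_add_left volume μ).comp
      (R.measurePreserving.comp (measurePreserving_sub_right volume μ))
  have hm : MeasurableSet {f : EuclideanSpace ℝ (Fin d) | f ∈ closedBall μ 1 ∧ ⟪f, w₂⟫ ≤ 0} := by
    refine (IsClosed.inter isClosed_closedBall ?_).measurableSet
    exact isClosed_le (f := fun f : EuclideanSpace ℝ (Fin d) => ⟪f, w₂⟫) (by fun_prop) continuous_const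
  rw [← hT.measure_preimage hm.nullMeasurableSet]
  refine measure_mono ?_
  rintro f ⟨hf, hf'⟩
  refine ⟨?_, ?_⟩
  · rw [mem_closedBall, dist_eq_norm] at hf ⊢
    rw [add_sub_cancel_left, R.norm_map]
    exact hf
  · have e : ⟪R (f - μ), w₂⟫ = ⟪f, w₁⟫ - ⟪μ, w₁⟫ := by
      rw [← hR, R.inner_map_map, inner_sub_left]
    rw [inner_add_left, e]
    linarith
end

section
/- Let d ≥ 1, let μ ∈ ℝ^d, let w ∈ ℝ^d with ‖w‖ = 1 and ⟪μ, w⟫ > 0, and let b ∈ ℝ be arbitrary. Then ε(w, 0) ≤ ε(w, b); i.e., among all biases, the zero bias minimizes the error rate of a fixed unit weight on the symmetric two-ball mixture. -/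
open MeasureTheory Metric RealInnerProductSpace

lemma shift_mem {d : ℕ} (μ w f : EuclideanSpace ℝ (Fin d)) (hw : ‖w‖ = 1)
    (hμw : 0 ≤ ⟪μ, w⟫) (hf : f ∈ closedBall μ 1) (hs : ⟪f, w⟫ ≤ 0) :
    f + ((2 * ⟪μ, w⟫) • w - (2 : ℝ) • μ) ∈ closedBall (-μ) 1 := by
  rw [mem_closedBall, dist_eq_norm] at hf ⊢
  have e : f + ((2 * ⟪μ, w⟫) • w - (2 : ℝ) • μ) - -μ = (f - μ) + (2 * ⟪μ, w⟫) • w := by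
    module
  rw [e]
  have h := norm_add_sq_real (f - μ) ((2 * ⟪μ, w⟫) • w)
  rw [inner_smul_right, inner_sub_left, norm_smul, hw, mul_one, Real.norm_eq_abs, sq_abs] at h
  have h2 : ‖f - μ + (2 * ⟪μ, w⟫) • w‖ ^ 2 ≤ ‖f - μ‖ ^ 2 := by
    nlinarith [mul_nonneg hμw (neg_nonneg.2 hs)]
  exact ((sq_le_sq₀ (norm_nonneg _) (norm_nonneg _)).1 h2).trans hf

lemma shift_inner {d : ℕ} (μ w f : EuclideanSpace ℝ (Fin d)) (hw : ‖w‖ = 1) :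
    ⟪f + ((2 * ⟪μ, w⟫) • w - (2 : ℝ) • μ), w⟫ = ⟪f, w⟫ := by
  rw [inner_add_left, inner_sub_left, real_inner_smul_left, real_inner_smul_left,
    real_inner_self_eq_norm_sq, hw]
  ring

lemma slab_le {d : ℕ} (μ w : EuclideanSpace ℝ (Fin d)) (hw : ‖w‖ = 1)
    (hμw : 0 ≤ ⟪μ, w⟫) (a c : ℝ) (hc : c ≤ 0) :
    volume {f : EuclideanSpace ℝ (Fin d) | f ∈ closedBall μ 1 ∧ a < ⟪f, w⟫ ∧ ⟪f, w⟫ ≤ c} ≤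
    volume {f : EuclideanSpace ℝ (Fin d) | f ∈ closedBall (-μ) 1 ∧ a < ⟪f, w⟫ ∧ ⟪f, w⟫ ≤ c} := by
  rw [← measure_preimage_add_right volume ((2 * ⟪μ, w⟫) • w - (2 : ℝ) • μ)
    {f : EuclideanSpace ℝ (Fin d) | f ∈ closedBall (-μ) 1 ∧ a < ⟪f, w⟫ ∧ ⟪f, w⟫ ≤ c}]
  apply measure_mono
  rintro f ⟨h1, h2, h3⟩
  refine ⟨shift_mem μ w f hw hμw h1 (h3.trans hc), ?_⟩
  rw [shift_inner μ w f hw]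
  exact ⟨h2, h3⟩

lemma slab_le' {d : ℕ} (μ w : EuclideanSpace ℝ (Fin d)) (hw : ‖w‖ = 1)
    (hμw : 0 ≤ ⟪μ, w⟫) (a c : ℝ) (ha : 0 ≤ a) :
    volume {f : EuclideanSpace ℝ (Fin d) | f ∈ closedBall (-μ) 1 ∧ a < ⟪f, w⟫ ∧ ⟪f, w⟫ ≤ c} ≤
    volume {f : EuclideanSpace ℝ (Fin d) | f ∈ closedBall μ 1 ∧ a < ⟪f, w⟫ ∧ ⟪f, w⟫ ≤ c} := by
  have e : ⟪-μ, -w⟫ = ⟪μ, w⟫ := inner_neg_neg μ w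
  have hw' : ‖-w‖ = 1 := by rw [norm_neg, hw]
  rw [← measure_preimage_add_right volume ((2 * ⟪-μ, -w⟫) • (-w) - (2 : ℝ) • (-μ))
    {f : EuclideanSpace ℝ (Fin d) | f ∈ closedBall μ 1 ∧ a < ⟪f, w⟫ ∧ ⟪f, w⟫ ≤ c}]
  apply measure_mono
  rintro f ⟨h1, h2, h3⟩
  have hm := shift_mem (-μ) (-w) f hw' (e ▸ hμw) h1 (by rw [inner_neg_right]; linarith)
  have hi := shift_inner (-μ) (-w) f hw'
  rw [inner_neg_right, inner_neg_right f, neg_inj] at hi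
  rw [neg_neg] at hm
  refine ⟨hm, ?_⟩
  rw [hi]
  exact ⟨h2, h3⟩

theorem stmt4 (d : ℕ) (hd : 1 ≤ d) (μ w : EuclideanSpace ℝ (Fin d))
    (hw : ‖w‖ = 1) (hμw : ⟪μ, w⟫ > 0) (b : ℝ) :
    errRate d μ w 0 ≤ errRate d μ w b := by
  have hmeas : Measurable fun f : EuclideanSpace ℝ (Fin d) => ⟪f, w⟫ := by fun_prop
  have hslab : ∀ (ν : EuclideanSpace ℝ (Fin d)) (a c : ℝ), MeasurableSet
      {f : EuclideanSpace ℝ (Fin d) | f ∈ closedBall ν 1 ∧ a < ⟪f, w⟫ ∧ ⟪f, w⟫ ≤ c} := by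
    intro ν a c
    exact measurableSet_closedBall.inter
      ((measurableSet_lt measurable_const hmeas).inter (measurableSet_le hmeas measurable_const))
  have hfin : ∀ (ν : EuclideanSpace ℝ (Fin d)) (p : EuclideanSpace ℝ (Fin d) → Prop),
      volume {f : EuclideanSpace ℝ (Fin d) | f ∈ closedBall ν 1 ∧ p f} ≠ ⊤ := by
    intro ν p
    exact measure_ne_top_of_subset (fun f hf => hf.1) measure_closedBall_lt_top.ne
  unfold errRate
  refine mul_le_mul_of_nonneg_left (div_le_div_of_nonneg_right ?_ ENNReal.toReal_nonneg)
    (by norm_num)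
  rw [← ENNReal.toReal_add (hfin _ _) (hfin _ _), ← ENNReal.toReal_add (hfin _ _) (hfin _ _)]
  refine ENNReal.toReal_mono (ENNReal.add_ne_top.2 ⟨hfin _ _, hfin _ _⟩) ?_
  rcases le_total 0 b with hb | hb
  · have h1 := slab_le μ w hw hμw.le (-b) 0 le_rfl
    have h2 : volume {f : EuclideanSpace ℝ (Fin d) | f ∈ closedBall (-μ) 1 ∧ ⟪f, w⟫ + 0 > 0}
        + volume {f : EuclideanSpace ℝ (Fin d) |
            f ∈ closedBall (-μ) 1 ∧ -b < ⟪f, w⟫ ∧ ⟪f, w⟫ ≤ 0}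
        ≤ volume {f : EuclideanSpace ℝ (Fin d) | f ∈ closedBall (-μ) 1 ∧ ⟪f, w⟫ + b > 0} := by
      rw [← measure_union _ (hslab _ _ _)]
      · apply measure_mono
        rintro f (⟨h, h'⟩ | ⟨h, h', h''⟩)
        · exact ⟨h, by linarith⟩
        · exact ⟨h, by linarith⟩
      · rw [Set.disjoint_left]
        rintro f ⟨_, h⟩ ⟨_, _, h'⟩
        linarith
    have h3 : volume {f : EuclideanSpace ℝ (Fin d) | f ∈ closedBall μ 1 ∧ ⟪f, w⟫ + 0 ≤ 0}
        ≤ volume {f : EuclideanSpace ℝ (Fin d) | f ∈ closedBall μ 1 ∧ -b < ⟪f, w⟫ ∧ ⟪f, w⟫ ≤ 0}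
        + volume {f : EuclideanSpace ℝ (Fin d) | f ∈ closedBall μ 1 ∧ ⟪f, w⟫ + b ≤ 0} := by
      refine (measure_mono ?_).trans (measure_union_le _ _)
      rintro f ⟨h, h'⟩
      rcases lt_or_ge (-b) ⟪f, w⟫ with h4 | h4
      · exact Or.inl ⟨h, h4, by linarith⟩
      · exact Or.inr ⟨h, by linarith⟩
    refine (add_le_add_right h3 _).trans ?_
    rw [← add_assoc]
    exact add_le_add_left ((add_le_add_right h1 _).trans h2) _
  · have h1 := slab_le' μ w hw hμw.le 0 (-b) le_rfl
    have h2 : volume {f : EuclideanSpace ℝ (Fin d) | f ∈ closedBall μ 1 ∧ ⟪f, w⟫ + 0 ≤ 0}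
        + volume {f : EuclideanSpace ℝ (Fin d) |
            f ∈ closedBall μ 1 ∧ 0 < ⟪f, w⟫ ∧ ⟪f, w⟫ ≤ -b}
        ≤ volume {f : EuclideanSpace ℝ (Fin d) | f ∈ closedBall μ 1 ∧ ⟪f, w⟫ + b ≤ 0} := by
      rw [← measure_union _ (hslab _ _ _)]
      · apply measure_mono
        rintro f (⟨h, h'⟩ | ⟨h, h', h''⟩)
        · exact ⟨h, by linarith⟩
        · exact ⟨h, by linarith⟩
      · rw [Set.disjoint_left]
        rintro f ⟨_, h⟩ ⟨_, h', _⟩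
        linarith
    have h3 : volume {f : EuclideanSpace ℝ (Fin d) | f ∈ closedBall (-μ) 1 ∧ ⟪f, w⟫ + 0 > 0}
        ≤ volume {f : EuclideanSpace ℝ (Fin d) | f ∈ closedBall (-μ) 1 ∧ ⟪f, w⟫ + b > 0}
        + volume {f : EuclideanSpace ℝ (Fin d) |
            f ∈ closedBall (-μ) 1 ∧ 0 < ⟪f, w⟫ ∧ ⟪f, w⟫ ≤ -b} := by
      refine (measure_mono ?_).trans (measure_union_le _ _)
      rintro f ⟨h, h'⟩
      rcases lt_or_ge (-b) ⟪f, w⟫ with h4 | h4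
      · exact Or.inl ⟨h, by linarith⟩
      · exact Or.inr ⟨h, by linarith, h4⟩
    refine (add_le_add_left h3 _).trans ?_
    rw [add_assoc, add_comm (volume {f : EuclideanSpace ℝ (Fin d) |
            f ∈ closedBall (-μ) 1 ∧ 0 < ⟪f, w⟫ ∧ ⟪f, w⟫ ≤ -b})]
    exact add_le_add_right ((add_le_add_right h1 _).trans h2) _
end

section
/- Let A, B, θ be real numbers with B ≥ 0 and 0 < θ < A. Define Δ = θ·√(1 + B²/(A² − θ²)). Then √(B² + (A + Δ)²) − √(B² + (A − Δ)²) = 2θ; i.e., Δ is the exact axial margin at which a point at perpendicular distance B from the axis joining the two prototypes ±A·w has distance-difference exactly 2θ to the two prototypes. -/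
theorem stmt7 (A B θ : ℝ) (hB : 0 ≤ B) (hθ : 0 < θ) (hθA : θ < A)
    (Δ : ℝ) (hΔ : Δ = θ * Real.sqrt (1 + B ^ 2 / (A ^ 2 - θ ^ 2))) :
    Real.sqrt (B ^ 2 + (A + Δ) ^ 2) - Real.sqrt (B ^ 2 + (A - Δ) ^ 2) = 2 * θ := by
  have hd : 0 < A ^ 2 - θ ^ 2 := by nlinarith
  have hq : 0 ≤ B ^ 2 / (A ^ 2 - θ ^ 2) := by positivity
  have h1 : 1 ≤ Real.sqrt (1 + B ^ 2 / (A ^ 2 - θ ^ 2)) :=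
    Real.one_le_sqrt.mpr (by linarith)
  have hs : Real.sqrt (1 + B ^ 2 / (A ^ 2 - θ ^ 2)) ^ 2 = 1 + B ^ 2 / (A ^ 2 - θ ^ 2) :=
    Real.sq_sqrt (by linarith)
  have hm : B ^ 2 / (A ^ 2 - θ ^ 2) * (A ^ 2 - θ ^ 2) = B ^ 2 := div_mul_cancel₀ _ hd.ne'
  generalize Real.sqrt (1 + B ^ 2 / (A ^ 2 - θ ^ 2)) = s at *
  have hk : s ^ 2 * (A ^ 2 - θ ^ 2) = A ^ 2 - θ ^ 2 + B ^ 2 := by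
    rw [hs, add_mul, hm]; ring
  subst hΔ
  have e1 : B ^ 2 + (A + θ * s) ^ 2 = (A * s + θ) ^ 2 := by linear_combination -hk
  have e2 : B ^ 2 + (A - θ * s) ^ 2 = (A * s - θ) ^ 2 := by linear_combination -hk
  rw [e1, e2, Real.sqrt_sq (by nlinarith), Real.sqrt_sq (by nlinarith)]
  ring
end

section
/- For every real Δ with 0 ≤ Δ ≤ 1, it holds that arccos(1 − Δ) ≤ (π/2)·√Δ. -/
theorem stmt8 (Δ : ℝ) (h0 : 0 ≤ Δ) (h1 : Δ ≤ 1) :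
    Real.arccos (1 - Δ) ≤ (Real.pi / 2) * Real.sqrt Δ := by
  have hs0 := Real.sqrt_nonneg Δ
  have hs1 : Real.sqrt Δ ≤ 1 := Real.sqrt_le_one.mpr h1
  have hsq : Real.sqrt Δ ^ 2 = Δ := Real.sq_sqrt h0
  generalize Real.sqrt Δ = s at *
  have hpi := Real.pi_pos
  have hc := strictConcaveOn_sin_Icc.concaveOn.2 (x := 0) (y := Real.pi / 4)
    ⟨le_refl _, hpi.le⟩ ⟨by linarith, by linarith⟩ (sub_nonneg.mpr hs1) hs0 (by ring)
  simp only [smul_eq_mul, Real.sin_zero, mul_zero, zero_add, Real.sin_pi_div_four] at hc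
  have h2 : Real.sqrt 2 ^ 2 = 2 := Real.sq_sqrt (by norm_num)
  have h3 : (s * (Real.sqrt 2 / 2)) ^ 2 ≤ Real.sin (s * (Real.pi / 4)) ^ 2 :=
    pow_le_pow_left₀ (by positivity) hc 2
  have h4 : (s * (Real.sqrt 2 / 2)) ^ 2 = Δ / 2 := by
    rw [mul_pow, div_pow, h2, hsq]; ring
  have h5 : Real.cos (Real.pi / 2 * s) = 1 - 2 * Real.sin (s * (Real.pi / 4)) ^ 2 := by
    have e : Real.pi / 2 * s = 2 * (s * (Real.pi / 4)) := by ring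
    rw [e, Real.cos_two_mul, Real.cos_sq']; ring
  have h6 : Real.cos (Real.pi / 2 * s) ≤ 1 - Δ := by linarith
  have h7 := Real.arccos_le_arccos h6
  rwa [Real.arccos_cos (by positivity) (by nlinarith)] at h7
end

section
/- For every natural number d, the ratio of Gamma function values satisfies ((d + 1)/2)/√(d/2 + 1) ≤ Γ(d/2 + 1)/Γ((d + 1)/2) ≤ √((d + 1)/2). -/
theorem gamma_half_le (x : ℝ) (hx : 0 < x) :
    Real.Gamma (x + 1 / 2) ≤ Real.sqrt x * Real.Gamma x := by
  have hG := Real.Gamma_pos_of_pos hx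
  have h := Real.Gamma_mul_add_mul_le_rpow_Gamma_mul_rpow_Gamma (s := x) (t := x + 1)
    (a := 1 / 2) (b := 1 / 2) hx (by linarith) (by norm_num) (by norm_num) (by norm_num)
  rw [← Real.sqrt_eq_rpow, ← Real.sqrt_eq_rpow, Real.Gamma_add_one hx.ne',
    Real.sqrt_mul hx.le] at h
  have e : 1 / 2 * x + 1 / 2 * (x + 1) = x + 1 / 2 := by ring
  rw [e] at h
  have := Real.mul_self_sqrt hG.le
  calc _ ≤ _ := h
    _ = Real.sqrt x * (Real.sqrt (Real.Gamma x) * Real.sqrt (Real.Gamma x)) := by ring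
    _ = _ := by rw [this]

theorem stmt10 (d : ℕ) :
    ((d : ℝ) + 1) / 2 / Real.sqrt ((d : ℝ) / 2 + 1)
        ≤ Real.Gamma ((d : ℝ) / 2 + 1) / Real.Gamma (((d : ℝ) + 1) / 2) ∧
      Real.Gamma ((d : ℝ) / 2 + 1) / Real.Gamma (((d : ℝ) + 1) / 2)
        ≤ Real.sqrt (((d : ℝ) + 1) / 2) := by
  have h1 : (0 : ℝ) < ((d : ℝ) + 1) / 2 := by positivity
  have h2 : (0 : ℝ) < (d : ℝ) / 2 + 1 := by positivity
  have hG := Real.Gamma_pos_of_pos h1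
  constructor
  · rw [div_le_div_iff₀ (Real.sqrt_pos.mpr h2) hG, ← Real.Gamma_add_one h1.ne']
    have h := gamma_half_le _ h2
    have e : (d : ℝ) / 2 + 1 + 1 / 2 = ((d : ℝ) + 1) / 2 + 1 := by ring
    rw [e] at h
    linarith
  · rw [div_le_iff₀ hG]
    have h := gamma_half_le _ h1
    have e : ((d : ℝ) + 1) / 2 + 1 / 2 = (d : ℝ) / 2 + 1 := by ring
    rwa [e] at h
end

section
/- Let d be a natural number and let θ ∈ [0, π/2]. Define the cap-to-ball volume ratio R(d, θ) := (π^((d−1)/2)/Γ((d + 1)/2) · ∫₀^θ sin^d(φ) dφ) / (π^(d/2)/Γ(d/2 + 1)). Then (1/√π)·(1/√(2d + 4))·(2/π)^d·θ^(d+1) ≤ R(d, θ) ≤ (1/√π)·(1/√(2d + 2))·θ^(d+1). -/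
/-- Cap-to-ball volume ratio: the volume of the `d`-dimensional spherical cap of radius 1 and
polar angle `θ` divided by the volume of the `d`-dimensional unit ball. -/
noncomputable def capBallRatio (d : ℕ) (θ : ℝ) : ℝ :=
  (Real.pi ^ (((d : ℝ) - 1) / 2) / Real.Gamma (((d : ℝ) + 1) / 2)
      * ∫ φ in (0 : ℝ)..θ, Real.sin φ ^ d)
    / (Real.pi ^ ((d : ℝ) / 2) / Real.Gamma ((d : ℝ) / 2 + 1))

lemma gamma_half_sq {x : ℝ} (hx : 0 < x) :
    Real.Gamma (x + 1/2) ≤ Real.sqrt x * Real.Gamma x := by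
  have h := Real.Gamma_mul_add_mul_le_rpow_Gamma_mul_rpow_Gamma (s := x) (t := x + 1)
    (a := 1/2) (b := 1/2) hx (by linarith) (by norm_num) (by norm_num) (by norm_num)
  have hG := Real.Gamma_pos_of_pos hx
  rw [Real.Gamma_add_one hx.ne', ← Real.sqrt_eq_rpow, ← Real.sqrt_eq_rpow,
    Real.sqrt_mul hx.le] at h
  have e : 1/2 * x + 1/2 * (x + 1) = x + 1/2 := by ring
  rw [e] at h
  have := Real.mul_self_sqrt hG.le
  calc _ ≤ _ := h
    _ = Real.sqrt x * (Real.sqrt (Real.Gamma x) * Real.sqrt (Real.Gamma x)) := by ring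
    _ = _ := by rw [this]

theorem stmt11 (d : ℕ) (θ : ℝ) (hθ : θ ∈ Set.Icc 0 (Real.pi / 2)) :
    (1 / Real.sqrt Real.pi) * (1 / Real.sqrt (2 * d + 4)) * (2 / Real.pi) ^ d * θ ^ (d + 1)
        ≤ capBallRatio d θ ∧
      capBallRatio d θ
        ≤ (1 / Real.sqrt Real.pi) * (1 / Real.sqrt (2 * d + 2)) * θ ^ (d + 1) := by
  obtain ⟨h0, h1⟩ := hθ
  have hpi := Real.pi_pos
  have hd : (0 : ℝ) ≤ d := Nat.cast_nonneg d
  have hxp : (0 : ℝ) < ((d : ℝ) + 1) / 2 := by positivity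
  have hyp : (0 : ℝ) < (d : ℝ) / 2 + 1 := by positivity
  have hA := Real.Gamma_pos_of_pos hxp
  have hB := Real.Gamma_pos_of_pos hyp
  have g1 := gamma_half_sq hxp
  have g2 := gamma_half_sq hyp
  have e1 : ((d : ℝ) + 1) / 2 + 1 / 2 = (d : ℝ) / 2 + 1 := by ring
  have e2 : (d : ℝ) / 2 + 1 + 1 / 2 = ((d : ℝ) + 1) / 2 + 1 := by ring
  rw [e1] at g1
  rw [e2, Real.Gamma_add_one hxp.ne'] at g2
  have hR : capBallRatio d θ = (1 / Real.sqrt Real.pi) *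
      ((Real.Gamma ((d : ℝ) / 2 + 1) / Real.Gamma (((d : ℝ) + 1) / 2)) *
        ∫ φ in (0 : ℝ)..θ, Real.sin φ ^ d) := by
    unfold capBallRatio
    have hp : Real.pi ^ (((d : ℝ) - 1) / 2) = Real.pi ^ ((d : ℝ) / 2) / Real.sqrt Real.pi := by
      rw [Real.sqrt_eq_rpow, ← Real.rpow_sub hpi]; congr 1; ring
    rw [hp]
    have : 0 < Real.pi ^ ((d : ℝ) / 2) := Real.rpow_pos_of_pos hpi _
    have : 0 < Real.sqrt Real.pi := Real.sqrt_pos.2 hpi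
    field_simp
  have hint : ∫ φ in (0 : ℝ)..θ, φ ^ d = θ ^ (d + 1) / (d + 1) := by
    rw [integral_pow]; simp
  have hU : ∫ φ in (0 : ℝ)..θ, Real.sin φ ^ d ≤ θ ^ (d + 1) / (d + 1) := by
    rw [← hint]
    apply intervalIntegral.integral_mono_on h0
    · exact Continuous.intervalIntegrable (by fun_prop) _ _
    · exact Continuous.intervalIntegrable (by fun_prop) _ _
    · intro x hx
      exact pow_le_pow_left₀ (Real.sin_nonneg_of_nonneg_of_le_pi hx.1 (by linarith [hx.2]))
        (Real.sin_le hx.1) d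
  have hL : (2 / Real.pi) ^ d * (θ ^ (d + 1) / (d + 1)) ≤ ∫ φ in (0 : ℝ)..θ, Real.sin φ ^ d := by
    rw [← hint, ← intervalIntegral.integral_const_mul]
    apply intervalIntegral.integral_mono_on h0
    · exact Continuous.intervalIntegrable (by fun_prop) _ _
    · exact Continuous.intervalIntegrable (by fun_prop) _ _
    · intro x hx
      rw [← mul_pow]
      have := hx.1
      exact pow_le_pow_left₀ (by positivity) (Real.mul_le_sin hx.1 (by linarith [hx.2])) d
  have s1 : Real.sqrt (2 * d + 2) = 2 * Real.sqrt (((d : ℝ) + 1) / 2) := by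
    rw [show (2 * d + 2 : ℝ) = 2 ^ 2 * (((d : ℝ) + 1) / 2) by ring, Real.sqrt_mul (by norm_num),
      Real.sqrt_sq (by norm_num)]
  have s2 : Real.sqrt (2 * d + 4) = 2 * Real.sqrt ((d : ℝ) / 2 + 1) := by
    rw [show (2 * d + 4 : ℝ) = 2 ^ 2 * ((d : ℝ) / 2 + 1) by ring, Real.sqrt_mul (by norm_num),
      Real.sqrt_sq (by norm_num)]
  have p1 := Real.sqrt_pos.2 hxp
  have p2 := Real.sqrt_pos.2 hyp
  have q1 := Real.mul_self_sqrt hxp.le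
  rw [hR, s1, s2]
  set G := Real.Gamma ((d : ℝ) / 2 + 1) / Real.Gamma (((d : ℝ) + 1) / 2) with hG
  have hG0 : 0 < G := div_pos hB hA
  have G1 : G ≤ Real.sqrt (((d : ℝ) + 1) / 2) := by
    rw [hG, div_le_iff₀ hA]; exact g1
  have G2 : ((d : ℝ) + 1) / 2 / Real.sqrt ((d : ℝ) / 2 + 1) ≤ G := by
    rw [hG, div_le_div_iff₀ p2 hA]; linarith
  rw [mul_assoc, mul_assoc, mul_assoc]
  constructor
  · apply mul_le_mul_of_nonneg_left _ (by positivity)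
    calc _ = ((d : ℝ) + 1) / 2 / Real.sqrt ((d : ℝ) / 2 + 1) *
          ((2 / Real.pi) ^ d * (θ ^ (d + 1) / (d + 1))) := by
            generalize Real.sqrt ((d : ℝ) / 2 + 1) = t at *
            field_simp
      _ ≤ _ := mul_le_mul G2 hL (by positivity) hG0.le
  · apply mul_le_mul_of_nonneg_left _ (by positivity)
    calc _ ≤ G * (θ ^ (d + 1) / (d + 1)) := mul_le_mul_of_nonneg_left hU hG0.le
      _ ≤ Real.sqrt (((d : ℝ) + 1) / 2) * (θ ^ (d + 1) / (d + 1)) :=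
        mul_le_mul_of_nonneg_right G1 (by positivity)
      _ = _ := by
        generalize Real.sqrt (((d : ℝ) + 1) / 2) = t at *
        have : (d : ℝ) + 1 = 2 * (t * t) := by linarith
        rw [this]
        field_simp
end

section
/- Let d ≥ 1, let u ∈ ℝ^d be a unit vector, and let θ ∈ [0, π]. Then the Lebesgue measure of the solid spherical cap {x ∈ closedBall(0, 1) ⊂ ℝ^d : ⟪x, u⟫ ≥ cos θ} equals π^((d−1)/2)/Γ((d + 1)/2) · ∫₀^θ sin^d(φ) dφ. -/
open MeasureTheory Metric RealInnerProductSpace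

lemma vol_ball_aux (n : ℕ) (r : ℝ) (hr : 0 ≤ r) :
    volume (closedBall (0 : EuclideanSpace ℝ (Fin n)) r) =
      ENNReal.ofReal (r ^ n * (Real.pi ^ ((n : ℝ) / 2) / Real.Gamma ((n : ℝ) / 2 + 1))) := by
  rcases n with _ | n
  · have : closedBall (0 : EuclideanSpace ℝ (Fin 0)) r = Set.univ := by
      ext x; simp [Subsingleton.elim x 0, hr]
    rw [this]
    have h := (EuclideanSpace.volume_preserving_symm_measurableEquiv_toLp (Fin 0)).measure_preimage
      (MeasurableSet.univ).nullMeasurableSet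
    rw [Set.preimage_univ] at h
    rw [h, volume_pi, Measure.pi_univ]
    simp
  · rw [EuclideanSpace.volume_closedBall, ← ENNReal.ofReal_pow hr, ← ENNReal.ofReal_mul (by positivity)]
    congr 3
    · rw [Fintype.card_fin]
    · rw [Real.sqrt_eq_rpow, ← Real.rpow_natCast, ← Real.rpow_mul Real.pi_pos.le]
      congr 1; simp; ring
    · simp

lemma cap_aux (n : ℕ) (θ : ℝ) (hθ : θ ∈ Set.Icc 0 Real.pi) :
    volume {x : EuclideanSpace ℝ (Fin (n+1)) | x ∈ closedBall 0 1 ∧ Real.cos θ ≤ x 0}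
     = ∫⁻ t in Set.Icc (Real.cos θ) 1, volume (closedBall (0 : EuclideanSpace ℝ (Fin n)) (√(1 - t^2))) := by
  have h1 := EuclideanSpace.volume_preserving_symm_measurableEquiv_toLp (Fin (n+1))
  have h2 := volume_preserving_piFinSuccAbove (fun _ : Fin (n+1) => ℝ) 0
  have h3 := (MeasurePreserving.id (volume : Measure ℝ)).prod (PiLp.volume_preserving_toLp (Fin n))
  have h := h3.comp (h2.comp h1)
  let S : Set (ℝ × EuclideanSpace ℝ (Fin n)) := {p | p.1^2 + ‖p.2‖^2 ≤ 1 ∧ Real.cos θ ≤ p.1}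
  have hS : MeasurableSet S := by
    have a : IsClosed {p : ℝ × EuclideanSpace ℝ (Fin n) | p.1^2 + ‖p.2‖^2 ≤ 1} :=
      isClosed_le (by fun_prop) (by fun_prop)
    have b : IsClosed {p : ℝ × EuclideanSpace ℝ (Fin n) | Real.cos θ ≤ p.1} :=
      isClosed_le (by fun_prop) (by fun_prop)
    exact a.measurableSet.inter b.measurableSet
  have key : {x : EuclideanSpace ℝ (Fin (n+1)) | x ∈ closedBall 0 1 ∧ Real.cos θ ≤ x 0} =
     (Prod.map id (WithLp.toLp 2) ∘ (MeasurableEquiv.piFinSuccAbove (fun _ : Fin (n+1) => ℝ) 0) ∘ (MeasurableEquiv.toLp 2 (Fin (n+1) → ℝ)).symm) ⁻¹' S := by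
    ext x
    have : ‖x‖ ≤ 1 ↔ ‖x‖^2 ≤ 1 := by
      rw [sq_le_one_iff₀ (norm_nonneg _)]
    simp only [Set.mem_ofPred_eq, mem_closedBall, dist_zero_right, this, Set.mem_preimage, S]
    simp [EuclideanSpace.norm_sq_eq, Fin.sum_univ_succ, MeasurableEquiv.piFinSuccAbove, Fin.tail, Fin.insertNthEquiv]
  rw [key, h.measure_preimage hS.nullMeasurableSet]
  change (volume.prod volume) S = _
  rw [Measure.prod_apply hS, ← lintegral_indicator measurableSet_Icc]
  congr 1
  ext t
  by_cases ht : t ∈ Set.Icc (Real.cos θ) 1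
  · rw [Set.indicator_of_mem ht]
    congr 1
    ext y
    have : 0 ≤ 1 - t^2 := by nlinarith [Real.neg_one_le_cos θ, ht.1, ht.2]
    simp only [S, Set.mem_preimage, Set.mem_ofPred_eq, ht.1, and_true, mem_closedBall, dist_zero_right]
    rw [Real.le_sqrt (norm_nonneg _) this]
    constructor <;> intro <;> linarith
  · rw [Set.indicator_of_notMem ht]
    convert measure_empty (μ := (volume : Measure (EuclideanSpace ℝ (Fin n))))
    ext y
    simp only [S, Set.mem_preimage, Set.mem_ofPred_eq, Set.mem_empty_iff_false, iff_false]
    rintro ⟨a, b⟩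
    exact ht ⟨b, by nlinarith [sq_nonneg ‖y‖]⟩

lemma int_aux (n : ℕ) (θ : ℝ) (hθ : θ ∈ Set.Icc 0 Real.pi) :
    ∫ t in (Real.cos θ)..1, √(1 - t^2) ^ n = ∫ φ in (0 : ℝ)..θ, Real.sin φ ^ (n+1) := by
  have h := intervalIntegral.integral_comp_mul_deriv (a := 0) (b := θ) (f := Real.cos) (f' := fun x => - Real.sin x)
    (g := fun t => √(1 - t^2) ^ n) (fun x _ => Real.hasDerivAt_cos x) (by fun_prop) (by fun_prop)
  rw [Real.cos_zero] at h
  rw [intervalIntegral.integral_symm, ← h, ← intervalIntegral.integral_neg]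
  apply intervalIntegral.integral_congr
  intro x hx
  rw [Set.uIcc_of_le hθ.1] at hx
  have hs : 0 ≤ Real.sin x := Real.sin_nonneg_of_nonneg_of_le_pi hx.1 (hx.2.trans hθ.2)
  simp only [Function.comp]
  rw [← Real.sin_sq, Real.sqrt_sq hs]
  ring

theorem stmt12 (d : ℕ) (hd : 1 ≤ d) (u : EuclideanSpace ℝ (Fin d)) (hu : ‖u‖ = 1)
    (θ : ℝ) (hθ : θ ∈ Set.Icc 0 Real.pi) :
    volume {x : EuclideanSpace ℝ (Fin d) | x ∈ closedBall 0 1 ∧ ⟪x, u⟫ ≥ Real.cos θ}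
      = ENNReal.ofReal (Real.pi ^ (((d : ℝ) - 1) / 2) / Real.Gamma (((d : ℝ) + 1) / 2)
          * ∫ φ in (0 : ℝ)..θ, Real.sin φ ^ d) := by
  obtain ⟨n, rfl⟩ : ∃ n, d = n + 1 := ⟨d - 1, by omega⟩
  obtain ⟨b, hb⟩ := Orthonormal.exists_orthonormalBasis_extension_of_card_eq (𝕜 := ℝ)
    (E := EuclideanSpace ℝ (Fin (n+1))) (ι := Fin (n+1)) (by simp) (v := fun _ => u) (s := {0})
    (by
      rw [orthonormal_iff_ite]
      rintro ⟨i, hi⟩ ⟨j, hj⟩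
      simp only [Set.mem_singleton_iff] at hi hj
      subst hi hj
      simp [hu])
  have hb0 : b 0 = u := hb 0 rfl
  have e : {x : EuclideanSpace ℝ (Fin (n+1)) | x ∈ closedBall 0 1 ∧ ⟪x, u⟫ ≥ Real.cos θ} =
      b.repr ⁻¹' {x | x ∈ closedBall 0 1 ∧ Real.cos θ ≤ x 0} := by
    ext x
    simp [b.repr_apply_apply, hb0, real_inner_comm]
  have hm : MeasurableSet {x : EuclideanSpace ℝ (Fin (n+1)) | x ∈ closedBall 0 1 ∧ Real.cos θ ≤ x 0} := by
    have a : IsClosed {x : EuclideanSpace ℝ (Fin (n+1)) | Real.cos θ ≤ x 0} :=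
      isClosed_le (by fun_prop) (by fun_prop)
    exact measurableSet_closedBall.inter a.measurableSet
  rw [e, b.repr.measurePreserving.measure_preimage hm.nullMeasurableSet, cap_aux n θ hθ]
  simp_rw [vol_ball_aux n _ (Real.sqrt_nonneg _)]
  have hG : 0 < Real.Gamma ((n : ℝ) / 2 + 1) := Real.Gamma_pos_of_pos (by positivity)
  have hc : Continuous fun t : ℝ => √(1 - t^2) ^ n * (Real.pi ^ ((n : ℝ) / 2) / Real.Gamma ((n : ℝ) / 2 + 1)) := by
    fun_prop
  rw [← ofReal_integral_eq_lintegral_ofReal (hc.continuousOn.integrableOn_Icc)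
    (Filter.Eventually.of_forall fun t => by positivity), integral_Icc_eq_integral_Ioc,
    ← intervalIntegral.integral_of_le (Real.cos_le_one θ), intervalIntegral.integral_mul_const,
    int_aux n θ hθ, mul_comm]
  congr 4 <;> push_cast <;> ring_nf
end

section
/- Let N be a natural number, let p ∈ (0, 1), and let k be a natural number with k < N·p. Then the lower binomial tail satisfies ∑_{j=0}^{k} (N choose j) · p^j · (1 − p)^(N−j) ≤ exp(−(N·p − k)²/(2·N·p)); i.e., for X distributed Binomial(N, p), Pr(X ≤ k) ≤ exp(−(N·p − k)²/(2·N·p)). -/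
theorem exp_neg_le_quad (t : ℝ) (ht : 0 ≤ t) : Real.exp (-t) ≤ 1 - t + t ^ 2 / 2 := by
  have h1 := Real.quadratic_le_exp_of_nonneg ht
  have hq : 0 < 1 - t + t ^ 2 / 2 := by nlinarith [sq_nonneg (t - 1)]
  rw [Real.exp_neg, inv_le_iff_one_le_mul₀ (Real.exp_pos t)]
  calc (1 : ℝ) ≤ (1 - t + t ^ 2 / 2) * (1 + t + t ^ 2 / 2) := by nlinarith [sq_nonneg (t ^ 2)]
    _ ≤ _ := mul_le_mul_of_nonneg_left h1 hq.le

theorem stmt13 (N : ℕ) (p : ℝ) (hp : p ∈ Set.Ioo (0 : ℝ) 1) (k : ℕ) (hk : (k : ℝ) < N * p) :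
    ∑ j ∈ Finset.range (k + 1), (N.choose j : ℝ) * p ^ j * (1 - p) ^ (N - j)
      ≤ Real.exp (-((N : ℝ) * p - k) ^ 2 / (2 * N * p)) := by
  obtain ⟨hp0, hp1⟩ := hp
  have hq : 0 < 1 - p := by linarith
  have hk0 : (0 : ℝ) ≤ k := Nat.cast_nonneg k
  have hN0 : (0 : ℝ) ≤ N := Nat.cast_nonneg N
  have hμ : 0 < (N : ℝ) * p := lt_of_le_of_lt hk0 hk
  have hkN : k < N := by
    have : (k : ℝ) < N := by nlinarith
    exact_mod_cast this
  set t : ℝ := ((N : ℝ) * p - k) / (N * p) with htd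
  have ht : 0 ≤ t := div_nonneg (by linarith) hμ.le
  have htμ : t * (N * p) = N * p - k := div_mul_cancel₀ _ hμ.ne'
  have step1 : ∑ j ∈ Finset.range (k + 1), (N.choose j : ℝ) * p ^ j * (1 - p) ^ (N - j)
      ≤ ∑ j ∈ Finset.range (N + 1),
        Real.exp (t * k) * ((p * Real.exp (-t)) ^ j * (1 - p) ^ (N - j) * (N.choose j : ℝ)) := by
    refine le_trans (Finset.sum_le_sum fun j hj => ?_)
      (Finset.sum_le_sum_of_subset_of_nonneg
        (Finset.range_mono (by omega : k + 1 ≤ N + 1)) fun j _ _ => by positivity)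
    have hjk : (j : ℝ) ≤ k := by
      exact_mod_cast Nat.lt_succ_iff.mp (Finset.mem_range.mp hj)
    have he : 1 ≤ Real.exp (t * k) * Real.exp (-t) ^ j := by
      rw [← Real.exp_nat_mul, ← Real.exp_add]
      apply Real.one_le_exp
      nlinarith
    calc (N.choose j : ℝ) * p ^ j * (1 - p) ^ (N - j)
        ≤ (Real.exp (t * k) * Real.exp (-t) ^ j) *
          ((N.choose j : ℝ) * p ^ j * (1 - p) ^ (N - j)) :=
          le_mul_of_one_le_left (by positivity) he
      _ = _ := by rw [mul_pow]; ring
  refine step1.trans ?_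
  rw [← Finset.mul_sum, ← add_pow]
  have hb : p * Real.exp (-t) + (1 - p) ≤ Real.exp (p * (-t + t ^ 2 / 2)) := by
    have h1 := mul_le_mul_of_nonneg_left (exp_neg_le_quad t ht) hp0.le
    have h2 := Real.add_one_le_exp (p * (-t + t ^ 2 / 2))
    linarith
  calc _ ≤ Real.exp (t * k) * Real.exp (p * (-t + t ^ 2 / 2)) ^ N := by gcongr
    _ = Real.exp (-((N : ℝ) * p - k) ^ 2 / (2 * N * p)) := by
      rw [← Real.exp_nat_mul, ← Real.exp_add]
      congr 1
      have hN : (N : ℝ) ≠ 0 := left_ne_zero_of_mul hμ.ne'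
      rw [htd]
      field_simp
      ring
end

section
/- Let d ≥ 1, let w ∈ ℝ^d be a unit vector, and let A > 0, Δ ≥ 0, B ≥ 0. Suppose f ∈ ℝ^d satisfies ⟪f, w⟫ ≤ −Δ and ‖f − ⟪f, w⟫·w‖ ≤ B. Then ‖f − A·w‖ − ‖f + A·w‖ ≥ √(B² + (A + Δ)²) − √(B² + (A − Δ)²). -/
open RealInnerProductSpace

lemma aux_conv (B x y l m : ℝ) (hl : 0 ≤ l) (hm : 0 ≤ m) (hlm : l + m = 1) :
    Real.sqrt (B ^ 2 + (l * x + m * y) ^ 2)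
      ≤ l * Real.sqrt (B ^ 2 + x ^ 2) + m * Real.sqrt (B ^ 2 + y ^ 2) := by
  have hP := Real.sq_sqrt (show 0 ≤ B ^ 2 + x ^ 2 by positivity)
  have hQ := Real.sq_sqrt (show 0 ≤ B ^ 2 + y ^ 2 by positivity)
  have hP0 := Real.sqrt_nonneg (B ^ 2 + x ^ 2)
  have hQ0 := Real.sqrt_nonneg (B ^ 2 + y ^ 2)
  set P := Real.sqrt (B ^ 2 + x ^ 2)
  set Q := Real.sqrt (B ^ 2 + y ^ 2)
  have hPQ : B ^ 2 + x * y ≤ P * Q := by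
    apply le_of_sq_le_sq _ (by positivity)
    rw [mul_pow, hP, hQ]
    nlinarith [sq_nonneg (B * (x - y))]
  apply Real.sqrt_le_iff.mpr
  refine ⟨by positivity, ?_⟩
  have h3 := mul_le_mul_of_nonneg_left hPQ (mul_nonneg hl hm)
  have e : (l * P + m * Q) ^ 2
      = l ^ 2 * (B ^ 2 + x ^ 2) + m ^ 2 * (B ^ 2 + y ^ 2) + 2 * (l * m * (P * Q)) := by
    rw [← hP, ← hQ]; ring
  have e2 : B ^ 2 = (l + m) ^ 2 * B ^ 2 := by rw [hlm]; ring
  rw [e]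
  nlinarith

lemma aux_t (A D B t : ℝ) (hA : 0 < A) (ht : D ≤ t) :
    Real.sqrt (B ^ 2 + (A + D) ^ 2) - Real.sqrt (B ^ 2 + (A - D) ^ 2)
      ≤ Real.sqrt (B ^ 2 + (A + t) ^ 2) - Real.sqrt (B ^ 2 + (A - t) ^ 2) := by
  have hs : 0 < t - D + 2 * A := by linarith
  have hl : 0 ≤ (t - D) / (t - D + 2 * A) := div_nonneg (by linarith) hs.le
  have hm : 0 ≤ (2 * A) / (t - D + 2 * A) := by positivity
  have hlm : (t - D) / (t - D + 2 * A) + (2 * A) / (t - D + 2 * A) = 1 := by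
    field_simp
  have a1 := aux_conv B (D - A) (A + t) _ _ hl hm hlm
  have a2 := aux_conv B (D - A) (A + t) _ _ hm hl (by linarith)
  have e1 : (t - D) / (t - D + 2 * A) * (D - A) + (2 * A) / (t - D + 2 * A) * (A + t)
      = A + D := by field_simp; ring
  have e2 : (2 * A) / (t - D + 2 * A) * (D - A) + (t - D) / (t - D + 2 * A) * (A + t)
      = t - A := by field_simp; ring
  rw [e1] at a1
  rw [e2] at a2
  rw [show (A - D) ^ 2 = (D - A) ^ 2 by ring, show (A - t) ^ 2 = (t - A) ^ 2 by ring]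
  set l := (t - D) / (t - D + 2 * A)
  have hm' : (2 * A) / (t - D + 2 * A) = 1 - l := by linarith
  rw [hm'] at a1 a2
  linarith

lemma aux_b (A B b t : ℝ) (hA : 0 < A) (ht : 0 ≤ t) (hb : 0 ≤ b) (hbB : b ≤ B) :
    Real.sqrt (B ^ 2 + (A + t) ^ 2) - Real.sqrt (B ^ 2 + (A - t) ^ 2)
      ≤ Real.sqrt (b ^ 2 + (A + t) ^ 2) - Real.sqrt (b ^ 2 + (A - t) ^ 2) := by
  have key : ∀ c : ℝ, Real.sqrt (c ^ 2 + (A + t) ^ 2) - Real.sqrt (c ^ 2 + (A - t) ^ 2)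
      = 4 * A * t / (Real.sqrt (c ^ 2 + (A + t) ^ 2) + Real.sqrt (c ^ 2 + (A - t) ^ 2)) := by
    intro c
    have h0 : 0 < Real.sqrt (c ^ 2 + (A + t) ^ 2) := by
      apply Real.sqrt_pos.mpr; positivity
    have h1 := Real.sq_sqrt (show 0 ≤ c ^ 2 + (A + t) ^ 2 by positivity)
    have h2 := Real.sq_sqrt (show 0 ≤ c ^ 2 + (A - t) ^ 2 by positivity)
    have h3 := Real.sqrt_nonneg (c ^ 2 + (A - t) ^ 2)
    rw [eq_div_iff (by positivity)]
    linarith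
  have h0 : 0 < Real.sqrt (b ^ 2 + (A + t) ^ 2) := by
    apply Real.sqrt_pos.mpr; positivity
  rw [key, key]
  gcongr

theorem stmt17 (d : ℕ) (hd : 1 ≤ d) (w : EuclideanSpace ℝ (Fin d)) (hw : ‖w‖ = 1)
    (A Δ B : ℝ) (hA : 0 < A) (hΔ : 0 ≤ Δ) (hB : 0 ≤ B)
    (f : EuclideanSpace ℝ (Fin d)) (h1 : ⟪f, w⟫ ≤ -Δ) (h2 : ‖f - ⟪f, w⟫ • w‖ ≤ B) :
    Real.sqrt (B ^ 2 + (A + Δ) ^ 2) - Real.sqrt (B ^ 2 + (A - Δ) ^ 2)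
      ≤ ‖f - A • w‖ - ‖f + A • w‖ := by
  have hn : ∀ c : ℝ, ‖f - c • w‖ ^ 2 = ‖f‖ ^ 2 - 2 * (c * ⟪f, w⟫) + c ^ 2 := by
    intro c
    rw [norm_sub_sq_real, inner_smul_right, norm_smul, hw, Real.norm_eq_abs, mul_one, sq_abs]
  have hb := hn ⟪f, w⟫
  have hp : ‖f - A • w‖ = Real.sqrt (‖f - ⟪f, w⟫ • w‖ ^ 2 + (A + -⟪f, w⟫) ^ 2) := by
    rw [eq_comm, Real.sqrt_eq_iff_mul_self_eq (by positivity) (norm_nonneg _), ← pow_two, hn A, hb]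
    ring
  have hq : ‖f + A • w‖ = Real.sqrt (‖f - ⟪f, w⟫ • w‖ ^ 2 + (A - -⟪f, w⟫) ^ 2) := by
    rw [show f + A • w = f - (-A) • w by simp]
    rw [eq_comm, Real.sqrt_eq_iff_mul_self_eq (by positivity) (norm_nonneg _), ← pow_two,
      hn (-A), hb]
    ring
  rw [hp, hq]
  exact (aux_t A Δ B (-⟪f, w⟫) hA (by linarith)).trans
    (aux_b A B _ _ hA (by linarith) (norm_nonneg _) h2)
end
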